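/- Let τ, l ∈ ℕ with l ≥ 1 and let G₁, …, G_l be independent geometric random variables with parameters p₁, …, p_l ∈ (0,1]. Let X = G₁ + G₂ + ⋯ + G_l and let Y = max{ i ∈ {0,1,…,l} : G₁ + ⋯ + G_i ≤ τ } (with the empty sum equal to 0). Then Σ_{t=τ+1}^{∞} t · Pr(X = t) = Σ_{i=0}^{l−1} Pr(Y = i) · (τ + Σ_{j=i+1}^{l} 1/p_j); equivalently, E[(X − τ) · 1{X > τ}] = Σ_{i=0}^{l−1} Pr(Y = i) · Σ_{j=i+1}^{l} 1/p_j. -/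

import Mathlib

open Finset

/-- `probSumLe p n τ` is the probability that `G₁ + ⋯ + G_n ≤ τ`, where
`G₁, …, G_n` are independent geometric random variables taking values in
`{1, 2, 3, …}` with `Pr(G_i = k) = p (i-1) * (1 - p (i-1)) ^ (k - 1)`
(i.e. with parameters `p 0, …, p (n-1)`).  It is computed by summing the joint
probability mass over all tuples of values `(k 0, …, k (n-1))`, each in
`{1, …, τ}`, whose total is at most `τ`. -/
noncomputable def probSumLe (p : ℕ → ℝ) (n τ : ℕ) : ℝ :=
  ∑ k ∈ (Fintype.piFinset fun _ : Fin n => Finset.Icc 1 τ).filter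
      (fun k => ∑ j, k j ≤ τ),
    ∏ j : Fin n, p j * (1 - p j) ^ (k j - 1)
/-- `probSumEq p n t` is the probability that `G₁ + ⋯ + G_n = t` for independent
geometric random variables (valued in `{1, 2, …}`) with parameters
`p 0, …, p (n-1)`. -/
noncomputable def probSumEq (p : ℕ → ℝ) (n t : ℕ) : ℝ :=
  ∑ k ∈ (Fintype.piFinset fun _ : Fin n => Finset.Icc 1 t).filter
      (fun k => ∑ j, k j = t),
    ∏ j : Fin n, p j * (1 - p j) ^ (k j - 1)

/-- The generating function of a geometric random variable on `{1, 2, …}`. -/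
noncomputable def geometricGF (a : ℝ) : PowerSeries ℝ :=
  PowerSeries.C a * PowerSeries.mk (fun n => (1 - a) ^ n) * PowerSeries.X

lemma coeff_geometricGF_of_pos (a : ℝ) {n : ℕ} (hn : 1 ≤ n) :
    PowerSeries.coeff n (geometricGF a) = a * (1 - a) ^ (n - 1) := by
  obtain ⟨m, rfl⟩ := Nat.exists_eq_add_of_le' hn
  rw [geometricGF, PowerSeries.coeff_succ_mul_X, PowerSeries.coeff_C_mul, PowerSeries.coeff_mk,
    Nat.add_sub_cancel]

lemma coeff_zero_geometricGF (a : ℝ) : PowerSeries.coeff 0 (geometricGF a) = 0 := by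
  rw [geometricGF, PowerSeries.coeff_zero_mul_X]

lemma geometricGF_eq (a : ℝ) :
    geometricGF a =
      PowerSeries.C a * PowerSeries.X + PowerSeries.C (1 - a) * geometricGF a * PowerSeries.X := by
  ext n
  rcases n with _ | _ | n
  · simp [coeff_zero_geometricGF]
  · rw [map_add, PowerSeries.coeff_succ_mul_X, PowerSeries.coeff_succ_mul_X,
      PowerSeries.coeff_C_mul, coeff_zero_geometricGF, coeff_geometricGF_of_pos a le_rfl]
    simp
  · rw [map_add, PowerSeries.coeff_succ_mul_X, PowerSeries.coeff_succ_mul_X,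
      PowerSeries.coeff_C_mul, coeff_geometricGF_of_pos a (by lia),
      coeff_geometricGF_of_pos a (by lia), PowerSeries.coeff_succ_C]
    simp only [Nat.add_sub_cancel]
    ring

lemma probSumEq_eq_coeff (p : ℕ → ℝ) (n t : ℕ) :
    probSumEq p n t = PowerSeries.coeff t (∏ j ∈ range n, geometricGF (p j)) := by
  rw [← Fin.prod_univ_eq_prod_range (fun j => geometricGF (p j)), PowerSeries.coeff_prod,
    probSumEq]
  refine Finset.sum_of_injOn (fun k => Finsupp.equivFunOnFinite.symm k)
    (Finsupp.equivFunOnFinite.symm.injective.injOn) ?_ ?_ ?_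
  · intro k hk
    simp only [coe_filter, Fintype.mem_piFinset, Set.mem_ofPred_eq] at hk
    simp [mem_finsuppAntidiag, hk.2]
  · intro k hk hk'
    obtain ⟨hsum, -⟩ := mem_finsuppAntidiag.1 hk
    obtain ⟨j, hj⟩ : ∃ j, k j = 0 := by
      by_contra! h
      refine hk' ⟨k, ?_, by simp⟩
      simp only [coe_filter, Fintype.mem_piFinset, Set.mem_ofPred_eq, mem_Icc]
      refine ⟨fun j => ⟨Nat.one_le_iff_ne_zero.2 (h j), ?_⟩, hsum⟩
      rw [← hsum]
      exact single_le_sum (fun _ _ => Nat.zero_le _) (mem_univ j)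
    exact prod_eq_zero (mem_univ j) (by rw [hj, coeff_zero_geometricGF])
  · intro k hk
    simp only [mem_filter, Fintype.mem_piFinset, mem_Icc] at hk
    exact prod_congr rfl fun j _ => (coeff_geometricGF_of_pos _ (hk.1 j).1).symm

lemma probSumEq_succ_zero (p : ℕ → ℝ) (n : ℕ) : probSumEq p (n + 1) 0 = 0 := by
  rw [probSumEq_eq_coeff, prod_range_succ, PowerSeries.coeff_mul, Finset.Nat.antidiagonal_zero,
    sum_singleton, coeff_zero_geometricGF, mul_zero]

lemma probSumEq_succ_succ (p : ℕ → ℝ) (n t : ℕ) :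
    probSumEq p (n + 1) (t + 1) =
      p n * probSumEq p n t + (1 - p n) * probSumEq p (n + 1) t := by
  simp only [probSumEq_eq_coeff, prod_range_succ]
  set A := ∏ j ∈ range n, geometricGF (p j)
  conv_lhs => rw [geometricGF_eq]
  rw [show A * (PowerSeries.C (p n) * PowerSeries.X +
      PowerSeries.C (1 - p n) * geometricGF (p n) * PowerSeries.X) =
      (PowerSeries.C (p n) * A + PowerSeries.C (1 - p n) * (A * geometricGF (p n))) *
        PowerSeries.X by ring, PowerSeries.coeff_succ_mul_X, map_add, PowerSeries.coeff_C_mul,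
    PowerSeries.coeff_C_mul]

lemma probSumLe_eq_sum (p : ℕ → ℝ) (n τ : ℕ) :
    probSumLe p n τ = ∑ t ∈ range (τ + 1), probSumEq p n t := by
  rw [probSumLe, ← sum_fiberwise_of_maps_to (g := fun k => ∑ j, k j) (t := range (τ + 1))]
  · refine sum_congr rfl fun t ht => ?_
    rw [probSumEq]
    refine sum_congr ?_ fun _ _ => rfl
    ext k
    simp only [mem_filter, Fintype.mem_piFinset, mem_Icc, mem_range] at ht ⊢
    constructor
    · rintro ⟨⟨h, -⟩, hs⟩
      exact ⟨fun j => ⟨(h j).1, hs ▸ single_le_sum (fun _ _ => Nat.zero_le _) (mem_univ j)⟩, hs⟩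
    · rintro ⟨h, hs⟩
      exact ⟨⟨fun j => ⟨(h j).1, (h j).2.trans (by lia)⟩, by lia⟩, hs⟩
  · intro k hk
    simp only [mem_filter, mem_range] at hk ⊢
    lia

lemma probSumLe_zero (p : ℕ → ℝ) (τ : ℕ) : probSumLe p 0 τ = 1 := by
  simp [probSumLe]

lemma probSumLe_succ_zero (p : ℕ → ℝ) (n : ℕ) : probSumLe p (n + 1) 0 = 0 := by
  simp [probSumLe_eq_sum, probSumEq_succ_zero]

lemma probSumLe_succ_right (p : ℕ → ℝ) (n τ : ℕ) :
    probSumLe p n (τ + 1) = probSumLe p n τ + probSumEq p n (τ + 1) := by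
  rw [probSumLe_eq_sum, sum_range_succ, ← probSumLe_eq_sum]

lemma probSumLe_succ_succ (p : ℕ → ℝ) (n τ : ℕ) :
    probSumLe p (n + 1) (τ + 1) =
      p n * probSumLe p n τ + (1 - p n) * probSumLe p (n + 1) τ := by
  rw [probSumLe_eq_sum, sum_range_succ', probSumEq_succ_zero]
  simp only [probSumEq_succ_succ, sum_add_distrib, ← mul_sum, ← probSumLe_eq_sum, add_zero]

/-- The `(n+1)`-st transmission completes at time `t + 1` iff exactly `n` are complete at time `t`
and the next trial succeeds. -/
lemma probSumEq_succ_succ_eq_mul (p : ℕ → ℝ) (n t : ℕ) :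
    probSumEq p (n + 1) (t + 1) = p n * (probSumLe p n t - probSumLe p (n + 1) t) := by
  linarith [probSumLe_succ_succ p n t, probSumLe_succ_right p (n + 1) t]

lemma probSumEq_nonneg {p : ℕ → ℝ} {n : ℕ} (hp_pos : ∀ i < n, 0 < p i)
    (hp_le : ∀ i < n, p i ≤ 1) (t : ℕ) : 0 ≤ probSumEq p n t :=
  sum_nonneg fun _ _ => prod_nonneg fun j _ =>
    mul_nonneg (hp_pos j j.2).le (pow_nonneg (sub_nonneg.2 (hp_le j j.2)) _)

lemma exists_abs_one_sub_probSumLe_le {p : ℕ → ℝ} {n : ℕ} (hp_pos : ∀ i < n, 0 < p i)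
    (hp_le : ∀ i < n, p i ≤ 1) :
    ∃ r C : ℝ, 0 ≤ r ∧ r < 1 ∧ ∀ t, |1 - probSumLe p n t| ≤ C * r ^ t := by
  induction n with
  | zero => exact ⟨0, 0, le_rfl, one_pos, fun t => by simp [probSumLe_zero]⟩
  | succ n ih =>
    obtain ⟨r, C, hr0, hr1, h⟩ := ih (fun i hi => hp_pos i (by lia)) (fun i hi => hp_le i (by lia))
    have hpos := hp_pos n (by lia)
    have hle := hp_le n (by lia)
    have hC : 0 ≤ C := by simpa using (abs_nonneg _).trans (h 0)
    set r' := max r (1 - p n / 2)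
    have hrnonneg : 0 ≤ r' := hr0.trans (le_max_left _ _)
    refine ⟨r', max 1 (2 * C), hrnonneg, max_lt hr1 (by linarith), fun t => ?_⟩
    induction t with
    | zero => simp [probSumLe_succ_zero]
    | succ t iht =>
      have hrt : C * r ^ t ≤ C * r' ^ t := by gcongr; exact le_max_left _ _
      have hrpow : 0 ≤ r' ^ t := pow_nonneg hrnonneg t
      have hC' := le_max_right 1 (2 * C)
      have hC1 := le_max_left 1 (2 * C)
      set C' := max 1 (2 * C)
      calc |1 - probSumLe p (n + 1) (t + 1)|
          = |p n * (1 - probSumLe p n t) + (1 - p n) * (1 - probSumLe p (n + 1) t)| := by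
            rw [probSumLe_succ_succ]; congr 1; ring
        _ ≤ p n * |1 - probSumLe p n t| + (1 - p n) * |1 - probSumLe p (n + 1) t| := by
            refine (abs_add_le _ _).trans (le_of_eq ?_)
            rw [abs_mul, abs_mul, abs_of_pos hpos, abs_of_nonneg (sub_nonneg.2 hle)]
        _ ≤ p n * (C' / 2 * r' ^ t) + (1 - p n) * (C' * r' ^ t) := by
            have hle' : 0 ≤ 1 - p n := sub_nonneg.2 hle
            have hCt : C * r' ^ t ≤ C' / 2 * r' ^ t := by gcongr; linarith
            gcongr
            exact (h t).trans (hrt.trans hCt)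
        _ = C' * r' ^ t * (1 - p n / 2) := by ring
        _ ≤ C' * r' ^ t * r' := by gcongr; exact le_max_right _ _
        _ = C' * r' ^ (t + 1) := by ring

lemma tendsto_mul_one_sub_probSumLe {p : ℕ → ℝ} {n : ℕ} (hp_pos : ∀ i < n, 0 < p i)
    (hp_le : ∀ i < n, p i ≤ 1) :
    Filter.Tendsto (fun t : ℕ => (t : ℝ) * (1 - probSumLe p n t)) Filter.atTop (nhds 0) := by
  obtain ⟨r, C, hr0, hr1, h⟩ := exists_abs_one_sub_probSumLe_le hp_pos hp_le
  have := (tendsto_self_mul_const_pow_of_lt_one hr0 hr1).const_mul C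
  rw [mul_zero] at this
  refine squeeze_zero_norm (fun t => ?_) this
  rw [norm_mul, Real.norm_natCast, Real.norm_eq_abs]
  calc (t : ℝ) * |1 - probSumLe p n t| ≤ t * (C * r ^ t) := by gcongr; exact h t
    _ = C * (t * r ^ t) := by ring

lemma tendsto_probSumLe {p : ℕ → ℝ} {n : ℕ} (hp_pos : ∀ i < n, 0 < p i)
    (hp_le : ∀ i < n, p i ≤ 1) :
    Filter.Tendsto (probSumLe p n) Filter.atTop (nhds 1) := by
  obtain ⟨r, C, hr0, hr1, h⟩ := exists_abs_one_sub_probSumLe_le hp_pos hp_le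
  have h0 := (tendsto_pow_atTop_nhds_zero_of_lt_one hr0 hr1).const_mul C
  rw [mul_zero] at h0
  have h1 := squeeze_zero_norm (a := fun t => C * r ^ t) (f := fun t => 1 - probSumLe p n t) h h0
  simpa using h1.const_sub 1

/-- The expected residual time: `E[E[X - τ | Y]; Y < l]`. -/
noncomputable def expectedResidual (p : ℕ → ℝ) (l τ : ℕ) : ℝ :=
  ∑ i ∈ range l, (probSumLe p i τ - probSumLe p (i + 1) τ) * ∑ j ∈ Ico i l, 1 / p j

lemma sum_probSumLe_sub (p : ℕ → ℝ) (l τ : ℕ) :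
    ∑ i ∈ range l, (probSumLe p i τ - probSumLe p (i + 1) τ) = 1 - probSumLe p l τ := by
  rw [sum_range_sub', probSumLe_zero]

lemma expectedResidual_eq_sum (p : ℕ → ℝ) (l τ : ℕ) :
    expectedResidual p l τ = ∑ j ∈ range l, (1 - probSumLe p (j + 1) τ) * (1 / p j) := by
  simp only [expectedResidual, ← sum_probSumLe_sub, sum_mul, mul_sum]
  refine sum_comm' fun i j => ?_
  simp only [mem_range, mem_Ico]
  lia

lemma expectedResidual_succ {p : ℕ → ℝ} {l : ℕ} (hp_pos : ∀ i < l, 0 < p i) (τ : ℕ) :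
    expectedResidual p l (τ + 1) = expectedResidual p l τ - (1 - probSumLe p l τ) := by
  rw [expectedResidual_eq_sum, expectedResidual_eq_sum, ← sum_probSumLe_sub, ← sum_sub_distrib]
  refine sum_congr rfl fun i hi => ?_
  have := (hp_pos i (mem_range.1 hi)).ne'
  rw [probSumLe_succ_right, probSumEq_succ_succ_eq_mul]
  field_simp
  ring

lemma tendsto_expectedResidual {p : ℕ → ℝ} {l : ℕ} (hp_pos : ∀ i < l, 0 < p i)
    (hp_le : ∀ i < l, p i ≤ 1) :
    Filter.Tendsto (expectedResidual p l) Filter.atTop (nhds 0) := by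
  rw [funext (expectedResidual_eq_sum p l)]
  rw [← sum_const_zero (s := range l)]
  refine tendsto_finsetSum _ fun i hi => ?_
  have hi := mem_range.1 hi
  have := ((tendsto_probSumLe (n := i + 1) (fun j hj => hp_pos j (by lia))
    (fun j hj => hp_le j (by lia))).const_sub 1).mul_const (1 / p i)
  simpa using this

lemma sum_range_ite_sub_mul_probSumEq {p : ℕ → ℝ} {l : ℕ} (hp_pos : ∀ i < l, 0 < p i)
    (τ m : ℕ) :
    ∑ t ∈ range (m + (τ + 1)), (if τ + 1 ≤ t then ((t : ℝ) - τ) * probSumEq p l t else 0) =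
      expectedResidual p l τ - expectedResidual p l (m + τ) - m * (1 - probSumLe p l (m + τ)) := by
  induction m with
  | zero =>
    rw [sum_eq_zero fun t ht => if_neg (by simpa using ht)]
    simp
  | succ m ih =>
    rw [add_right_comm, sum_range_succ, ih, if_pos (by lia), add_right_comm,
      expectedResidual_succ hp_pos, probSumLe_succ_right, ← add_assoc m τ 1]
    push_cast
    ring

lemma sum_range_ite_probSumEq (p : ℕ → ℝ) (l τ m : ℕ) :
    ∑ t ∈ range (m + (τ + 1)), (if τ + 1 ≤ t then probSumEq p l t else 0) =
      probSumLe p l (m + τ) - probSumLe p l τ := by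
  induction m with
  | zero =>
    rw [sum_eq_zero fun t ht => if_neg (by simpa using ht)]
    simp
  | succ m ih =>
    rw [add_right_comm, sum_range_succ, ih, if_pos (by lia), add_right_comm,
      probSumLe_succ_right, ← add_assoc m τ 1]
    ring

lemma hasSum_ite_probSumEq {p : ℕ → ℝ} {l : ℕ} (hp_pos : ∀ i < l, 0 < p i)
    (hp_le : ∀ i < l, p i ≤ 1) (τ : ℕ) :
    HasSum (fun t => if τ + 1 ≤ t then probSumEq p l t else 0) (1 - probSumLe p l τ) := by
  rw [hasSum_iff_tendsto_nat_of_nonneg, ← Filter.tendsto_add_atTop_iff_nat (τ + 1)]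
  · simp only [sum_range_ite_probSumEq]
    exact ((Filter.tendsto_add_atTop_iff_nat τ).2 (tendsto_probSumLe hp_pos hp_le)).sub_const _
  · intro t
    split_ifs
    exacts [probSumEq_nonneg hp_pos hp_le t, le_rfl]

lemma hasSum_ite_sub_mul_probSumEq {p : ℕ → ℝ} {l : ℕ} (hp_pos : ∀ i < l, 0 < p i)
    (hp_le : ∀ i < l, p i ≤ 1) (τ : ℕ) :
    HasSum (fun t : ℕ => if τ + 1 ≤ t then ((t : ℝ) - τ) * probSumEq p l t else 0)
      (expectedResidual p l τ) := by
  rw [hasSum_iff_tendsto_nat_of_nonneg, ← Filter.tendsto_add_atTop_iff_nat (τ + 1)]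
  · simp only [sum_range_ite_sub_mul_probSumEq hp_pos]
    have hR := (Filter.tendsto_add_atTop_iff_nat τ).2 (tendsto_expectedResidual hp_pos hp_le)
    have hU := (Filter.tendsto_add_atTop_iff_nat τ).2
      (tendsto_mul_one_sub_probSumLe hp_pos hp_le)
    have hF := (((Filter.tendsto_add_atTop_iff_nat τ).2
      (tendsto_probSumLe hp_pos hp_le)).const_sub 1).const_mul (τ : ℝ)
    convert ((hR.const_sub (expectedResidual p l τ)).sub hU).add hF using 2
    · push_cast
      ring
    · ring
  · intro t
    split_ifs with h
    · have : (τ : ℝ) ≤ t := by exact_mod_cast (Nat.le_succ τ).trans h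
      exact mul_nonneg (sub_nonneg.2 this) (probSumEq_nonneg hp_pos hp_le t)
    · exact le_rfl

/-- memoryless residual identity: with `X = G₁ + ⋯ + G_l` and
`Y = max{ i ≤ l : G₁ + ⋯ + G_i ≤ τ }`, whose distribution is given by
`Pr(Y = i) = Pr(G₁ + ⋯ + G_i ≤ τ) − Pr(G₁ + ⋯ + G_{i+1} ≤ τ)` (the events are
nested since the partial sums are increasing):
`Σ_{t=τ+1}^∞ t·Pr(X = t) = Σ_{i=0}^{l-1} Pr(Y = i)·(τ + Σ_{j=i+1}^{l} 1/p_j)`,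
and equivalently
`E[(X − τ)·1{X > τ}] = Σ_{i=0}^{l-1} Pr(Y = i)·Σ_{j=i+1}^{l} 1/p_j`
(here, 0-indexed, `Σ_{j=i+1}^{l} 1/p_j` is the sum over `j ∈ [i, l)`). -/
theorem stmt17 (τ l : ℕ) (hl : 1 ≤ l) (p : ℕ → ℝ)
    (hp_pos : ∀ i < l, 0 < p i) (hp_le : ∀ i < l, p i ≤ 1) :
    ((∑' t : ℕ, if τ + 1 ≤ t then (t : ℝ) * probSumEq p l t else 0)
      = ∑ i ∈ Finset.range l, (probSumLe p i τ - probSumLe p (i + 1) τ) *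
          ((τ : ℝ) + ∑ j ∈ Finset.Ico i l, 1 / p j))
    ∧ (∑' t : ℕ, if τ + 1 ≤ t then ((t : ℝ) - (τ : ℝ)) * probSumEq p l t else 0)
      = ∑ i ∈ Finset.range l, (probSumLe p i τ - probSumLe p (i + 1) τ) *
          (∑ j ∈ Finset.Ico i l, 1 / p j) := by
  have hres := hasSum_ite_sub_mul_probSumEq hp_pos hp_le τ
  refine ⟨?_, hres.tsum_eq⟩
  have h := ((hasSum_ite_probSumEq hp_pos hp_le τ).mul_left (τ : ℝ)).add hres
  simp only [mul_add, sum_add_distrib, ← sum_mul, sum_probSumLe_sub]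
  rw [mul_comm (1 - _), ← expectedResidual]
  refine Eq.trans (tsum_congr fun t => ?_) h.tsum_eq
  split_ifs <;> ring
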